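/- arXiv:1204.1668 — 2 statements merged into one kernel-verified Lean document; each statement's English description precedes it below -/
import Mathlib

section
/- For finite abelian groups G and H, μ(G × H) = μ(G) + μ(H). -/
noncomputable def minFaithfulDegree (G : Type*) [Group G] : ℕ :=
  sInf {n : ℕ | ∃ f : G →* Equiv.Perm (Fin n), Function.Injective f}

theorem aux_zmod (p k : ℕ) (hp : p.Prime) (x y : ZMod (p ^ k))
    (h : Nat.gcd x.val (p ^ k) ∣ Nat.gcd y.val (p ^ k)) : ∃ m : ℤ, y = m • x := by
  haveI : NeZero (p ^ k) := ⟨pow_ne_zero _ hp.ne_zero⟩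
  obtain ⟨c, hc⟩ := h.trans (Nat.gcd_dvd_left _ _)
  refine ⟨c * Nat.gcdA x.val (p ^ k), ?_⟩
  have hb := Nat.gcd_eq_gcd_ab x.val (p ^ k)
  have hb' : ((Nat.gcd x.val (p ^ k) : ℕ) : ZMod (p ^ k)) = x * (Nat.gcdA x.val (p ^ k) : ℤ) := by
    have := congrArg (Int.cast : ℤ → ZMod (p ^ k)) hb
    push_cast at this
    have h0 : (p : ZMod (p ^ k)) ^ k = 0 := by
      rw [← Nat.cast_pow]; exact ZMod.natCast_self _
    rw [h0] at this
    simpa using this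
  have hy : y = ((y.val : ℕ) : ZMod (p ^ k)) := (ZMod.natCast_zmod_val y).symm
  rw [hy, hc, Nat.cast_mul, hb', zsmul_eq_mul]
  push_cast
  ring

theorem aux_total (p k : ℕ) (hp : p.Prime) (x y : Multiplicative (ZMod (p ^ k))) :
    (∃ m : ℤ, y = x ^ m) ∨ (∃ m : ℤ, x = y ^ m) := by
  obtain ⟨i, _, hi⟩ := (Nat.dvd_prime_pow hp).1 (Nat.gcd_dvd_right (x.toAdd).val (p ^ k))
  obtain ⟨j, _, hj⟩ := (Nat.dvd_prime_pow hp).1 (Nat.gcd_dvd_right (y.toAdd).val (p ^ k))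
  rcases le_total i j with h | h
  · left
    obtain ⟨m, hm⟩ := aux_zmod p k hp x.toAdd y.toAdd (by rw [hi, hj]; exact pow_dvd_pow p h)
    exact ⟨m, Multiplicative.toAdd.injective (by rw [hm, toAdd_zpow])⟩
  · right
    obtain ⟨m, hm⟩ := aux_zmod p k hp y.toAdd x.toAdd (by rw [hi, hj]; exact pow_dvd_pow p h)
    exact ⟨m, Multiplicative.toAdd.injective (by rw [hm, toAdd_zpow])⟩

/-- one exchange step -/
theorem aux_step {A : Type*} [CommGroup A] (N : Subgroup A) (p k : ℕ) (hp : p.Prime)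
    (χ α β : A →* Multiplicative (ZMod (p ^ k))) (hab : ∀ a, χ a = α a * β a)
    (hχ : ∀ a ∈ N, χ a = 1 → a = 1) :
    (∀ a ∈ N, α a = 1 → a = 1) ∨ (∀ a ∈ N, β a = 1 → a = 1) := by
  by_contra! hcon
  obtain ⟨⟨x, hxN, hx, hx1⟩, ⟨y, hyN, hy, hy1⟩⟩ := hcon
  have hinj : ∀ a ∈ N, ∀ b ∈ N, χ a = χ b → a = b := fun a ha b hb h => by
    rw [← div_eq_one]
    exact hχ _ (N.div_mem ha hb) (by rw [map_div, h, div_self'])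
  rcases aux_total p k hp (χ x) (χ y) with ⟨m, hm⟩ | ⟨m, hm⟩
  · have : y = x ^ m := hinj _ hyN _ (N.zpow_mem hxN m) (by rw [hm, map_zpow])
    apply hy1
    apply hχ _ hyN
    rw [hab, hy, this, map_zpow, hx, one_zpow, one_mul]
  · have : x = y ^ m := hinj _ hxN _ (N.zpow_mem hyN m) (by rw [hm, map_zpow])
    apply hx1
    apply hχ _ hxN
    rw [hab, hx, this, map_zpow, hy, one_zpow, one_mul]

def auxPr (A : Type*) [CommGroup A] (π : Bool → (A →* A)) : Option Bool → (A →* A)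
  | none => MonoidHom.id A
  | some b => π b

theorem aux_exchange {A : Type*} [CommGroup A] (π : Bool → (A →* A))
    (hπ : ∀ a, a = π true a * π false a)
    {ι : Type} [Fintype ι] (p e : ι → ℕ) (hp : ∀ i, (p i).Prime)
    (χ : ∀ i, A →* Multiplicative (ZMod (p i ^ e i)))
    (hχ : ∀ a, (∀ i, χ i a = 1) → a = 1) (T : Finset ι) :
    ∃ s : ι → Option Bool, (∀ i ∈ T, s i ≠ none) ∧
      ∀ a, (∀ i, χ i (auxPr A π (s i) a) = 1) → a = 1 := by
  classical
  induction T using Finset.induction_on with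
  | empty => exact ⟨fun _ => none, by simp, fun a h => hχ a h⟩
  | insert j T hj ih =>
    obtain ⟨s, hs, hinj⟩ := ih
    by_cases hsj : s j = none
    swap
    · refine ⟨s, ?_, hinj⟩
      intro i hi
      rcases Finset.mem_insert.1 hi with rfl | hi
      · exact hsj
      · exact hs i hi
    let N : Subgroup A := ⨅ i : {i // i ≠ j}, ((χ i).comp (auxPr A π (s i))).ker
    have hN : ∀ a, a ∈ N ↔ ∀ i, i ≠ j → χ i (auxPr A π (s i) a) = 1 := by
      intro a
      simp only [N, Subgroup.mem_iInf, MonoidHom.mem_ker, MonoidHom.comp_apply, Subtype.forall]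
    have key := aux_step N (p j) (e j) (hp j) (χ j) ((χ j).comp (π true)) ((χ j).comp (π false))
      (fun a => by
        simp only [MonoidHom.comp_apply]
        rw [← map_mul, ← hπ]) (fun a ha h => by
        apply hinj
        intro i
        by_cases hij : i = j
        · subst hij; rw [hsj]; exact h
        · exact (hN a).1 ha i hij)
    have fin : ∀ b : Bool, (∀ a ∈ N, (χ j).comp (π b) a = 1 → a = 1) →
        ∃ s : ι → Option Bool, (∀ i ∈ insert j T, s i ≠ none) ∧
          ∀ a, (∀ i, χ i (auxPr A π (s i) a) = 1) → a = 1 := by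
      intro b hb
      refine ⟨Function.update s j (some b), ?_, ?_⟩
      · intro i hi
        by_cases hij : i = j
        · subst hij; simp
        · rw [Function.update_of_ne hij]
          exact hs i ((Finset.mem_insert.1 hi).resolve_left hij)
      · intro a ha
        apply hb a
        · rw [hN]
          intro i hij
          have := ha i
          rwa [Function.update_of_ne hij] at this
        · have := ha j
          rwa [Function.update_self] at this
    rcases key with h | h
    · exact fin true h
    · exact fin false h

def auxWt (q : ℕ) : ℕ := if q = 1 then 0 else q

theorem auxWt_mul (a b : ℕ) (ha : a ≠ 0) (hb : b ≠ 0) :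
    auxWt a + auxWt b ≤ auxWt (a * b) := by
  unfold auxWt
  by_cases h1 : a = 1
  · subst h1; simp
  by_cases h2 : b = 1
  · subst h2; simp
  have h3 : a * b ≠ 1 := by
    intro h; exact h1 (Nat.eq_one_of_mul_eq_one_right h)
  rw [if_neg h1, if_neg h2, if_neg h3]
  have : 2 ≤ a := by omega
  have : 2 ≤ b := by omega
  nlinarith

theorem auxWt_prod {ι : Type} (s : Finset ι) (q : ι → ℕ) (hq : ∀ i, q i ≠ 0) :
    ∑ i ∈ s, auxWt (q i) ≤ auxWt (∏ i ∈ s, q i) := by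
  classical
  induction s using Finset.induction_on with
  | empty => simp
  | insert j T hj ih =>
    rw [Finset.sum_insert hj, Finset.prod_insert hj]
    exact (Nat.add_le_add_left ih _).trans
      (auxWt_mul _ _ (hq j) (Finset.prod_ne_zero_iff.2 fun i _ => hq i))

theorem auxWt_le (q : ℕ) : auxWt q ≤ q := by
  unfold auxWt; split_ifs <;> omega

theorem aux_perm {A : Type*} [Group A] {X : Type*} [Finite X]
    (f : A →* Equiv.Perm X) (hf : Function.Injective f) :
    minFaithfulDegree A ≤ Nat.card X := by
  apply Nat.sInf_le
  exact ⟨(Finite.equivFin X).permCongrHom.toMonoidHom.comp f,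
    (Finite.equivFin X).permCongrHom.injective.comp hf⟩

theorem aux_spec (A : Type*) [Group A] [Finite A] :
    ∃ f : A →* Equiv.Perm (Fin (minFaithfulDegree A)), Function.Injective f := by
  apply Nat.sInf_mem (s := {n : ℕ | ∃ f : A →* Equiv.Perm (Fin n), Function.Injective f})
  exact ⟨Nat.card A, (Finite.equivFin A).permCongrHom.toMonoidHom.comp (MulAction.toPermHom A A),
    (Finite.equivFin A).permCongrHom.injective.comp MulAction.toPerm_injective⟩

theorem aux_cyc (q : ℕ) (hq : q ≠ 0) :
    ∃ f : Multiplicative (ZMod q) →* Equiv.Perm (Fin (auxWt q)), Function.Injective f := by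
  by_cases h : q = 1
  · subst h
    exact ⟨1, Function.injective_of_subsingleton _⟩
  · haveI : NeZero q := ⟨hq⟩
    have hc : Nat.card (Multiplicative (ZMod q)) = auxWt q := by
      rw [auxWt, if_neg h, Nat.card_congr Multiplicative.toAdd, Nat.card_zmod]
    rw [← hc]
    exact ⟨(Finite.equivFin _).permCongrHom.toMonoidHom.comp (MulAction.toPermHom _ _),
      (Finite.equivFin _).permCongrHom.injective.comp MulAction.toPerm_injective⟩

theorem aux_upper {A : Type*} [CommGroup A] {ι : Type} [Fintype ι] (q : ι → ℕ)
    (hq : ∀ i, q i ≠ 0) (χ : ∀ i, A →* Multiplicative (ZMod (q i)))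
    (hχ : ∀ a, (∀ i, χ i a = 1) → a = 1) :
    minFaithfulDegree A ≤ ∑ i, auxWt (q i) := by
  choose f hf using fun i => aux_cyc (q i) (hq i)
  have := aux_perm (X := Σ i, Fin (auxWt (q i)))
    ((Equiv.Perm.sigmaCongrRightHom _).comp (MonoidHom.pi fun i => (f i).comp (χ i)))
    (Equiv.Perm.sigmaCongrRightHom_injective.comp (by
      rw [injective_iff_map_eq_one]
      intro a ha
      apply hχ
      intro i
      apply hf i
      rw [map_one]
      exact congrFun ha i))
  simpa [Nat.card_eq_fintype_card] using this

theorem aux_struct (Q : Type*) [CommGroup Q] [Finite Q] :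
    ∃ (ι : Type) (_ : Fintype ι) (p e : ι → ℕ) (_ : ∀ i, (p i).Prime)
      (χ : ∀ i, Q →* Multiplicative (ZMod (p i ^ e i))),
      (∀ a, (∀ i, χ i a = 1) → a = 1) ∧ ∑ i, auxWt (p i ^ e i) ≤ Nat.card Q := by
  classical
  obtain ⟨ι, _, p, hp, e, ⟨l⟩⟩ := AddCommGroup.equiv_directSum_zmod_of_finite (Additive Q)
  let l' : Additive Q ≃+ (∀ i, ZMod (p i ^ e i)) := l.trans (DirectSum.addEquivProd _)
  refine ⟨ι, inferInstance, p, e, hp, fun i =>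
    AddMonoidHom.toMultiplicativeRight ((Pi.evalAddMonoidHom _ i).comp l'.toAddMonoidHom), ?_, ?_⟩
  · intro a ha
    have : l' (Additive.ofMul a) = 0 := funext fun i => congrArg Multiplicative.toAdd (ha i)
    rw [map_eq_zero_iff l' l'.injective] at this
    exact this
  · have hc : Nat.card Q = ∏ i, p i ^ e i := by
      rw [Nat.card_congr (Additive.ofMul.trans l'.toEquiv), Nat.card_pi]
      simp
    rw [hc]
    exact (auxWt_prod _ _ fun i => pow_ne_zero _ (hp i).ne_zero).trans (auxWt_le _)

theorem aux_data {A : Type*} [CommGroup A] [Finite A] (n : ℕ) (f : A →* Equiv.Perm (Fin n))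
    (hf : Function.Injective f) :
    ∃ (ι : Type) (_ : Fintype ι) (p e : ι → ℕ) (_ : ∀ i, (p i).Prime)
      (χ : ∀ i, A →* Multiplicative (ZMod (p i ^ e i))),
      (∀ a, (∀ i, χ i a = 1) → a = 1) ∧ ∑ i, auxWt (p i ^ e i) ≤ n := by
  classical
  letI : MulAction A (Fin n) := MulAction.compHom (Fin n) f
  have hsm : ∀ (a : A) (x : Fin n), a • x = f a x := fun a x => rfl
  let Ω := MulAction.orbitRel.Quotient A (Fin n)
  haveI : Fintype Ω := Fintype.ofFinite _
  choose ι hι p e hp χ hχ hsum using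
    fun ω : Ω => aux_struct (A ⧸ MulAction.stabilizer A (Quotient.out ω))
  refine ⟨Σ ω, ι ω, inferInstance, fun i => p i.1 i.2, fun i => e i.1 i.2, fun i => hp i.1 i.2,
    fun i => (χ i.1 i.2).comp (QuotientGroup.mk' _), ?_, ?_⟩
  · intro a ha
    have hst : ∀ ω : Ω, a • (Quotient.out ω : Fin n) = Quotient.out ω := by
      intro ω
      have := hχ ω (QuotientGroup.mk' _ a) (fun i => ha ⟨ω, i⟩)
      exact (QuotientGroup.eq_one_iff a).1 this
    apply hf
    rw [map_one]
    ext x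
    have hx : (Quotient.out (Quotient.mk'' x : Ω)) ∈ MulAction.orbit A x :=
      MulAction.orbitRel_apply.1 (Quotient.mk_out (s := MulAction.orbitRel A (Fin n)) x)
    obtain ⟨g, hg⟩ := hx
    have h1 := hst (Quotient.mk'' x)
    have hg' : g • x = Quotient.out (Quotient.mk'' x : Ω) := hg
    rw [← hg', smul_smul, mul_comm, mul_smul] at h1
    have h2 := MulAction.injective g h1
    rw [← hsm, h2]
    rfl
  · rw [Fintype.sum_sigma]
    refine (Finset.sum_le_sum fun ω _ => hsum ω).trans ?_
    have := Nat.card_congr (MulAction.selfEquivSigmaOrbitsQuotientStabilizer A (Fin n))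
    rw [Nat.card_sigma, Nat.card_eq_fintype_card, Fintype.card_fin] at this
    exact this.ge

theorem mu_prod_abelian (G H : Type*) [CommGroup G] [CommGroup H] [Finite G] [Finite H] :
    minFaithfulDegree (G × H) = minFaithfulDegree G + minFaithfulDegree H := by
  classical
  apply le_antisymm
  · obtain ⟨f, hf⟩ := aux_spec G
    obtain ⟨g, hg⟩ := aux_spec H
    have := aux_perm ((Equiv.Perm.sumCongrHom _ _).comp (f.prodMap g))
      (Equiv.Perm.sumCongrHom_injective.comp (Function.Injective.prodMap hf hg))
    simpa [Nat.card_eq_fintype_card] using this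
  · obtain ⟨f, hf⟩ := aux_spec (G × H)
    obtain ⟨ι, _, p, e, hp, χ, hχ, hsum⟩ := aux_data _ f hf
    let π : Bool → (G × H →* G × H) := fun b =>
      if b then (MonoidHom.inl G H).comp (MonoidHom.fst G H)
      else (MonoidHom.inr G H).comp (MonoidHom.snd G H)
    obtain ⟨s, hs, hinj⟩ := aux_exchange π (fun a => by ext <;> simp [π]) p e hp χ hχ Finset.univ
    have hq : ∀ i, p i ^ e i ≠ 0 := fun i => pow_ne_zero _ (hp i).ne_zero
    have hG := aux_upper (A := G) (ι := {i // s i = some true}) (fun i => p i ^ e i)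
      (fun i => hq i) (fun i => (χ i).comp (MonoidHom.inl G H)) (by
        intro g hg
        have : ((g, 1) : G × H) = 1 := by
          apply hinj
          intro i
          rcases hsi : s i with _ | b
          · exact absurd hsi (hs i (Finset.mem_univ i))
          · cases b
            · exact map_one (χ i)
            · exact hg ⟨i, hsi⟩
        exact congrArg Prod.fst this)
    have hH := aux_upper (A := H) (ι := {i // ¬ s i = some true}) (fun i => p i ^ e i)
      (fun i => hq i) (fun i => (χ i).comp (MonoidHom.inr G H)) (by
        intro g hg
        have : ((1, g) : G × H) = 1 := by
          apply hinj
          intro i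
          rcases hsi : s i with _ | b
          · exact absurd hsi (hs i (Finset.mem_univ i))
          · cases b
            · exact hg ⟨i, by simp [hsi]⟩
            · exact map_one (χ i)
        exact congrArg Prod.snd this)
    refine (Nat.add_le_add hG hH).trans (le_trans (le_of_eq ?_) hsum)
    exact Fintype.sum_subtype_add_sum_subtype (fun i => s i = some true)
      (fun i => auxWt (p i ^ e i))
end

section
/- Let G and H be finite groups in the class CS (socle contained in center). Then μ(G × H) = μ(G) + μ(H). -/
def IsMinimalNormal {G : Type*} [Group G] (N : Subgroup G) : Prop :=
  N.Normal ∧ N ≠ ⊥ ∧ ∀ M : Subgroup G, M.Normal → M ≠ ⊥ → M ≤ N → M = N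

def socle (G : Type*) [Group G] : Subgroup G :=
  ⨆ N ∈ {N : Subgroup G | IsMinimalNormal N}, N

namespace MuProd

theorem exists_minNormal {G : Type*} [Group G] [Finite G] (N : Subgroup G) (hN : N.Normal)
    (hb : N ≠ ⊥) : ∃ M, IsMinimalNormal M ∧ M ≤ N := by
  obtain ⟨M, hM⟩ := (Set.toFinite {M : Subgroup G | M.Normal ∧ M ≠ ⊥ ∧ M ≤ N}).exists_minimal
    ⟨N, hN, hb, le_rfl⟩
  refine ⟨M, ⟨hM.prop.1, hM.prop.2.1, fun K hK hKb hKM => ?_⟩, hM.prop.2.2⟩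
  exact le_antisymm hKM (hM.2 ⟨hK, hKb, hKM.trans hM.prop.2.2⟩ hKM)

theorem le_socle {G : Type*} [Group G] {M : Subgroup G} (h : IsMinimalNormal M) :
    M ≤ socle G :=
  le_iSup₂_of_le (f := fun (N : Subgroup G) (_ : N ∈ {N : Subgroup G | IsMinimalNormal N}) => N)
    M h le_rfl

theorem normal_eq_bot {G : Type*} [Group G] [Finite G] (N : Subgroup G) (hN : N.Normal)
    (h : ∀ x ∈ N, x ∈ socle G → x = 1) : N = ⊥ := by
  by_contra hb
  obtain ⟨M, hM, hMN⟩ := exists_minNormal N hN hb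
  exact hM.2.1 ((Subgroup.eq_bot_iff_forall _).2 fun x hx => h x (hMN hx) (le_socle hM hx))

theorem socle_le_of_prime {G : Type*} [Group G] [Finite G] (hG : socle G ≤ Subgroup.center G)
    (M : Subgroup G) (h : ∀ x ∈ socle G, (orderOf x).Prime → x ∈ M) : socle G ≤ M := by
  refine iSup₂_le fun N hN => ?_
  have hN' : IsMinimalNormal N := hN
  obtain ⟨n, hn, hn1⟩ := Subgroup.ne_bot_iff_exists_ne_one.1 hN'.2.1 |>.elim
    fun a ha => (⟨a.1, a.2, fun h => ha (Subtype.ext h)⟩ : ∃ n, n ∈ N ∧ n ≠ 1)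
  have h1 : orderOf n ≠ 1 := fun h => hn1 (orderOf_eq_one_iff.1 h)
  obtain ⟨p, hp, k, hk⟩ := Nat.exists_prime_and_dvd h1
  have h0 : orderOf n ≠ 0 := (orderOf_pos n).ne'
  have hc : orderOf (n ^ k) = p := by
    have hk0 : k ≠ 0 := by rintro rfl; exact h0 (by rw [hk, mul_zero])
    rw [orderOf_pow_of_dvd hk0 ⟨p, by rw [hk, mul_comm]⟩, hk,
      Nat.mul_div_cancel _ (Nat.pos_of_ne_zero hk0)]
  have hcN : n ^ k ∈ N := N.pow_mem hn k
  have hcS := le_socle hN' hcN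
  have hnorm : (Subgroup.zpowers (n ^ k)).Normal := by
    constructor
    intro a ha g
    have : a ∈ Subgroup.center G := (Subgroup.zpowers_le.2 (hG hcS)) ha
    rw [Subgroup.mem_center_iff.1 this g]
    simpa using ha
  have := hN'.2.2 _ hnorm (by
    rw [Ne, Subgroup.zpowers_eq_bot]
    intro h; rw [h, orderOf_one] at hc; exact hp.one_lt.ne hc) (Subgroup.zpowers_le.2 hcN)
  rw [← this, Subgroup.zpowers_le]
  exact h _ hcS (hc ▸ hp)

/-- `L` is good for `S`. -/
def Good {Γ : Type*} [Group Γ] (S L : Subgroup Γ) : Prop :=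
  ∀ w ∈ S, w ∉ L → ∀ s ∈ S, ∃ l ∈ L, ∃ i : ℤ, s = l * w ^ i

/-- extension of a subgroup by a central element -/
def ext {Γ : Type*} [Group Γ] (L : Subgroup Γ) (w : Γ) (hw : w ∈ Subgroup.center Γ) :
    Subgroup Γ where
  carrier := {x | ∃ l ∈ L, ∃ i : ℤ, x = l * w ^ i}
  one_mem' := ⟨1, L.one_mem, 0, by simp⟩
  mul_mem' := by
    rintro _ _ ⟨l, hl, i, rfl⟩ ⟨m, hm, j, rfl⟩
    refine ⟨l * m, L.mul_mem hl hm, i + j, ?_⟩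
    have := Subgroup.mem_center_iff.1 ((Subgroup.center Γ).zpow_mem hw i) m
    rw [zpow_add, mul_assoc, ← mul_assoc (w ^ i), ← this]
    simp only [mul_assoc]
  inv_mem' := by
    rintro _ ⟨l, hl, i, rfl⟩
    refine ⟨l⁻¹, L.inv_mem hl, -i, ?_⟩
    have := Subgroup.mem_center_iff.1 ((Subgroup.center Γ).zpow_mem hw (-i)) l⁻¹
    rw [this, mul_inv_rev, zpow_neg]

theorem two_mul_index {Γ : Type*} [Group Γ] [Finite Γ] {L M : Subgroup Γ} (h : L ≤ M) {w : Γ}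
    (hw : w ∈ M) (hw' : w ∉ L) : 2 * M.index ≤ L.index := by
  rw [← Subgroup.relIndex_mul_index h]
  refine Nat.mul_le_mul_right _ ?_
  have h1 : L.relIndex M ≠ 1 := fun h1 => hw' (Subgroup.relIndex_eq_one.1 h1 hw)
  have h0 : L.relIndex M ≠ 0 := Subgroup.index_ne_zero_of_finite
  omega

theorem zpow_eq_one_of_mem {Γ : Type*} [Group Γ] (M : Subgroup Γ) (s : Γ)
    (hp : (orderOf s).Prime) (hs : s ∉ M) (j : ℤ) (hj : s ^ j ∈ M) : s ^ j = 1 := by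
  rw [← orderOf_dvd_iff_zpow_eq_one]
  by_contra hd
  have hc : IsCoprime ((orderOf s : ℕ) : ℤ) j :=
    (Prime.coprime_iff_not_dvd (Nat.prime_iff_prime_int.1 hp)).2 hd
  obtain ⟨a, b, hab⟩ := hc
  apply hs
  have : s = (s ^ j) ^ b := by
    rw [← zpow_mul]
    conv_lhs => rw [← zpow_one s, ← hab, zpow_add, mul_comm a, zpow_mul, zpow_natCast,
      pow_orderOf_eq_one, one_zpow, one_mul, mul_comm]
  rw [this]
  exact M.zpow_mem hj b

theorem split {Γ : Type*} [Group Γ] [Finite Γ] (S : Subgroup Γ) (hS : S ≤ Subgroup.center Γ)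
    (hgen : ∀ M : Subgroup Γ, (∀ x ∈ S, (orderOf x).Prime → x ∈ M) → S ≤ M) :
    ∀ (n : ℕ) (L : Subgroup Γ), L.index ≤ n → ∃ l : List (Subgroup Γ), (∀ M ∈ l, Good S M) ∧
      (l.map Subgroup.index).sum ≤ L.index ∧ ∀ x, (∀ M ∈ l, x ∈ M) → x ∈ L := by
  intro n
  induction n with
  | zero =>
    intro L hL
    exact absurd (Nat.le_zero.1 hL) Subgroup.index_ne_zero_of_finite
  | succ n ih =>
    intro L hL
    by_cases hg : Good S L
    · exact ⟨[L], by simpa using hg, by simp, fun x hx => by simpa using hx⟩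
    unfold Good at hg
    push Not at hg
    obtain ⟨w, hwS, hwL, s₀, hs₀, hs₀'⟩ := hg
    have hnot : ¬ S ≤ ext L w (hS hwS) := fun h => by
      obtain ⟨l, hl, i, hi⟩ := h hs₀
      exact hs₀' l hl i hi
    have hex : ∃ s ∈ S, (orderOf s).Prime ∧ s ∉ ext L w (hS hwS) := by
      by_contra hcon
      push Not at hcon
      exact hnot (hgen _ hcon)
    obtain ⟨s, hsS, hsp, hsM⟩ := hex
    have hle : ∀ (v : Γ) (hv), L ≤ ext L v hv := fun v hv x hx => ⟨x, hx, 0, by simp⟩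
    have hmem : ∀ (v : Γ) (hv), v ∈ ext L v hv := fun v hv => ⟨1, L.one_mem, 1, by simp⟩
    have i1 := two_mul_index (hle w (hS hwS)) (hmem w _) hwL
    have i2 := two_mul_index (hle s (hS hsS)) (hmem s _) (fun h => hsM (hle _ _ h))
    have p1 : (ext L w (hS hwS)).index ≠ 0 := Subgroup.index_ne_zero_of_finite
    have p2 : (ext L s (hS hsS)).index ≠ 0 := Subgroup.index_ne_zero_of_finite
    obtain ⟨l1, a1, b1, c1⟩ := ih (ext L w (hS hwS)) (by omega)
    obtain ⟨l2, a2, b2, c2⟩ := ih (ext L s (hS hsS)) (by omega)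
    refine ⟨l1 ++ l2, ?_, ?_, ?_⟩
    · intro M hM
      rcases List.mem_append.1 hM with h | h
      exacts [a1 M h, a2 M h]
    · rw [List.map_append, List.sum_append]; omega
    · intro x hx
      have hx1 := c1 x fun M hM => hx M (List.mem_append_left _ hM)
      obtain ⟨l, hl, j, rfl⟩ := c2 x fun M hM => hx M (List.mem_append_right _ hM)
      have : s ^ j ∈ ext L w (hS hwS) :=
        (Subgroup.mul_mem_cancel_left _ (hle w (hS hwS) hl)).1 hx1
      rw [zpow_eq_one_of_mem _ s hsp hsM j this, mul_one]
      exact hl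

theorem split_list {Γ : Type*} [Group Γ] [Finite Γ] (S : Subgroup Γ)
    (hS : S ≤ Subgroup.center Γ)
    (hgen : ∀ M : Subgroup Γ, (∀ x ∈ S, (orderOf x).Prime → x ∈ M) → S ≤ M)
    (k : List (Subgroup Γ)) : ∃ l : List (Subgroup Γ), (∀ M ∈ l, Good S M) ∧
      (l.map Subgroup.index).sum ≤ (k.map Subgroup.index).sum ∧
      ∀ x, (∀ M ∈ l, x ∈ M) → ∀ M ∈ k, x ∈ M := by
  induction k with
  | nil => exact ⟨[], by simp, by simp, by simp⟩
  | cons L k ih =>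
    obtain ⟨l1, a1, b1, c1⟩ := split S hS hgen _ L le_rfl
    obtain ⟨l2, a2, b2, c2⟩ := ih
    refine ⟨l1 ++ l2, ?_, ?_, ?_⟩
    · intro M hM
      rcases List.mem_append.1 hM with h | h
      exacts [a1 M h, a2 M h]
    · rw [List.map_append, List.sum_append, List.map_cons, List.sum_cons]; omega
    · intro x hx M hM
      rcases List.mem_cons.1 hM with rfl | h
      · exact c1 x fun M hM => hx M (List.mem_append_left _ hM)
      · exact c2 x (fun M hM => hx M (List.mem_append_right _ hM)) M h

theorem index_comap_le {G Γ : Type*} [Group G] [Group Γ] [Finite Γ] (f : G →* Γ)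
    (L : Subgroup Γ) : (L.comap f).index ≤ L.index := by
  rw [Subgroup.index_comap]
  rw [← Subgroup.relIndex_top_right L]
  refine Subgroup.relIndex_le_of_le_right le_top ?_
  rw [Subgroup.relIndex_top_right]
  exact Subgroup.index_ne_zero_of_finite

theorem exchange {G H : Type*} [Group G] [Group H] [Finite G] [Finite H]
    (S : Subgroup (G × H)) (l : List (Subgroup (G × H))) (hl : ∀ M ∈ l, Good S M) :
    ∀ W : Subgroup (G × H), W ≤ S → (∀ x ∈ W, (∀ M ∈ l, x ∈ M) → x = 1) →
    ∃ (a : List (Subgroup G)) (b : List (Subgroup H)),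
      (a.map Subgroup.index).sum + (b.map Subgroup.index).sum ≤ (l.map Subgroup.index).sum ∧
      ∀ x ∈ W, (∀ A ∈ a, x.1 ∈ A) → (∀ B ∈ b, x.2 ∈ B) → x = 1 := by
  induction l with
  | nil => 
    intro W _ h
    exact ⟨[], [], by simp, fun x hx _ _ => h x hx (by simp)⟩
  | cons L l ih =>
    intro W hW h
    obtain ⟨a, b, hsum, hab⟩ := ih (fun M hM => hl M (List.mem_cons_of_mem _ hM)) (W ⊓ L)
      (inf_le_left.trans hW) (fun x hx hx' => h x hx.1 fun M hM => by
        rcases List.mem_cons.1 hM with rfl | hM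
        exacts [hx.2, hx' M hM])
    have hgood := hl L List.mem_cons_self
    have iG := index_comap_le (MonoidHom.inl G H) L
    have iH := index_comap_le (MonoidHom.inr G H) L
    by_cases h1 : ∀ x ∈ W, (∀ A ∈ L.comap (MonoidHom.inl G H) :: a, x.1 ∈ A) →
        (∀ B ∈ b, x.2 ∈ B) → x = 1
    · refine ⟨L.comap (MonoidHom.inl G H) :: a, b, ?_, h1⟩
      simp only [List.map_cons, List.sum_cons]; omega
    refine ⟨a, L.comap (MonoidHom.inr G H) :: b, ?_, ?_⟩
    · simp only [List.map_cons, List.sum_cons]; omega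
    push Not at h1
    obtain ⟨w, hwW, hwa, hwb, hw1⟩ := h1
    intro v hvW hva hvb
    have hwL : w ∉ L := fun hwL => hw1 (hab w ⟨hwW, hwL⟩
      (fun A hA => hwa A (List.mem_cons_of_mem _ hA)) hwb)
    obtain ⟨t, htL, i, hti⟩ := hgood w (hW hwW) hwL v (hW hvW)
    have htv : t = v * (w ^ i)⁻¹ := by rw [hti]; simp
    have ht1 : t = 1 := by
      apply hab t ⟨?_, htL⟩ 
      · intro A hA
        rw [htv]
        exact A.mul_mem (hva A hA)
          (A.inv_mem (A.zpow_mem (hwa A (List.mem_cons_of_mem _ hA)) i))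
      · intro B hB
        rw [htv]
        exact B.mul_mem (hvb B (List.mem_cons_of_mem _ hB))
          (B.inv_mem (B.zpow_mem (hwb B hB) i))
      · rw [htv]
        exact W.mul_mem hvW (W.inv_mem (W.zpow_mem hwW i))
    rw [ht1, one_mul] at hti
    have e1 : ((v.1, 1) : G × H) ∈ L := by
      have h0 : ((w.1, 1) : G × H) ∈ L := hwa _ List.mem_cons_self
      have := L.zpow_mem h0 i
      rw [hti]
      convert this using 1
      ext <;> simp
    have e2 : ((1, v.2) : G × H) ∈ L := hvb _ List.mem_cons_self
    have e3 : v ∈ L := by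
      have := L.mul_mem e1 e2
      simpa using this
    exact hab v ⟨hvW, e3⟩ hva (fun B hB => hvb B (List.mem_cons_of_mem _ hB))

theorem exists_hom {G : Type*} [Group G] [Finite G] (a : List (Subgroup G)) :
    ∃ f : G →* Equiv.Perm (Fin (a.map Subgroup.index).sum), ∀ A ∈ a, f.ker ≤ A := by
  induction a with
  | nil => exact ⟨1, by simp⟩
  | cons A a ih =>
    obtain ⟨f, hf⟩ := ih
    let e : G ⧸ A ≃ Fin A.index := Finite.equivFinOfCardEq rfl
    let g : G →* Equiv.Perm (G ⧸ A) := MulAction.toPermHom G (G ⧸ A)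
    let c := (e.sumCongr (Equiv.refl _)).trans
      (finSumFinEquiv (m := A.index) (n := (a.map Subgroup.index).sum))
    have hs : ((A :: a).map Subgroup.index).sum = A.index + (a.map Subgroup.index).sum := by simp
    rw [hs]
    refine ⟨(c.permCongrHom.toMonoidHom.comp
      (Equiv.Perm.sumCongrHom (G ⧸ A) _)).comp (g.prod f), ?_⟩
    have key : ∀ x, ((c.permCongrHom.toMonoidHom.comp
      (Equiv.Perm.sumCongrHom (G ⧸ A) _)).comp (g.prod f)) x = 1 → g x = 1 ∧ f x = 1 := by
      intro x hx
      have h1 : Equiv.Perm.sumCongrHom (G ⧸ A) _ ((g.prod f) x) = 1 :=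
        c.permCongrHom.injective (by rw [map_one]; exact hx)
      have h2 : (g.prod f) x = 1 := Equiv.Perm.sumCongrHom_injective (by rw [map_one]; exact h1)
      exact ⟨congrArg Prod.fst h2, congrArg Prod.snd h2⟩
    intro B hB x hx
    obtain ⟨k1, k2⟩ := key x hx
    rcases List.mem_cons.1 hB with rfl | hB
    · have h3 : g x ((1 : G) : G ⧸ B) = ((1 : G) : G ⧸ B) := by rw [k1]; rfl
      have h4 : ((x * 1 : G) : G ⧸ B) = ((1 : G) : G ⧸ B) := h3
      rw [mul_one] at h4
      have := QuotientGroup.eq.1 h4.symm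
      simpa using this
    · exact hf B hB k2

theorem mu_le {G : Type*} [Group G] [Finite G] (a : List (Subgroup G))
    (h : ∀ x ∈ socle G, (∀ A ∈ a, x ∈ A) → x = 1) :
    minFaithfulDegree G ≤ (a.map Subgroup.index).sum := by
  obtain ⟨f, hf⟩ := exists_hom a
  refine Nat.sInf_le ⟨f, ?_⟩
  rw [← MonoidHom.ker_eq_bot_iff]
  exact normal_eq_bot _ inferInstance fun x hx hs => h x hs fun A hA => hf A hA hx

theorem mu_spec (G : Type*) [Group G] [Finite G] :
    ∃ f : G →* Equiv.Perm (Fin (minFaithfulDegree G)), Function.Injective f := by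
  apply Nat.sInf_mem (s := {n : ℕ | ∃ f : G →* Equiv.Perm (Fin n), Function.Injective f})
  obtain ⟨f, hf⟩ := exists_hom [(⊥ : Subgroup G)]
  refine ⟨_, f, ?_⟩
  rw [← MonoidHom.ker_eq_bot_iff]
  exact le_bot_iff.1 (hf ⊥ (by simp))

theorem orbits_list {Γ : Type*} [Group Γ] [Finite Γ] (n : ℕ) (f : Γ →* Equiv.Perm (Fin n))
    (hf : Function.Injective f) : ∃ l : List (Subgroup Γ), (l.map Subgroup.index).sum = n ∧
      ∀ x ∈ Subgroup.center Γ, (∀ M ∈ l, x ∈ M) → x = 1 := by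
  classical
  letI : MulAction Γ (Fin n) := MulAction.compHom _ f
  have hsm : ∀ (g : Γ) (i : Fin n), g • i = f g i := fun _ _ => rfl
  let Ω := MulAction.orbitRel.Quotient Γ (Fin n)
  letI : Fintype Ω := Fintype.ofFinite _
  have e : Fin n ≃ Σ ω : Ω, Γ ⧸ MulAction.stabilizer Γ ω.out :=
    MulAction.selfEquivSigmaOrbitsQuotientStabilizer Γ (Fin n)
  refine ⟨(Finset.univ : Finset Ω).toList.map fun ω => MulAction.stabilizer Γ ω.out, ?_, ?_⟩
  · have := Nat.card_congr e
    rw [Nat.card_sigma, Nat.card_eq_fintype_card, Fintype.card_fin] at this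
    rw [List.map_map, Finset.sum_map_toList]
    exact this.symm
  · intro x hx h
    apply hf
    rw [map_one]
    ext i : 1
    have h1 : x ∈ MulAction.stabilizer Γ (Quotient.mk'' i : Ω).out :=
      h _ (List.mem_map.2 ⟨_, by simp, rfl⟩)
    have h2 : (MulAction.orbitRel Γ (Fin n)).r (Quotient.mk'' i : Ω).out i :=
      Quotient.mk_out (s := MulAction.orbitRel Γ (Fin n)) i
    obtain ⟨g, hg⟩ := h2
    have hg' : g • i = (Quotient.mk'' i : Ω).out := hg
    rw [← hg', MulAction.mem_stabilizer_iff, ← mul_smul, ← Subgroup.mem_center_iff.1 hx g,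
      mul_smul] at h1
    exact MulAction.injective g h1

theorem mu_prod_le (G H : Type*) [Group G] [Group H] [Finite G] [Finite H] :
    minFaithfulDegree (G × H) ≤ minFaithfulDegree G + minFaithfulDegree H := by
  obtain ⟨f, hf⟩ := mu_spec G
  obtain ⟨g, hg⟩ := mu_spec H
  refine Nat.sInf_le ⟨(finSumFinEquiv.permCongrHom.toMonoidHom.comp
      (Equiv.Perm.sumCongrHom _ _)).comp (f.prodMap g), ?_⟩
  exact (finSumFinEquiv.permCongrHom.injective.comp Equiv.Perm.sumCongrHom_injective).comp
    (hf.prodMap hg)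

end MuProd

theorem mu_prod_of_central_socle (G H : Type*) [Group G] [Group H] [Finite G] [Finite H]
    [Nontrivial G] [Nontrivial H]
    (hG : socle G ≤ Subgroup.center G) (hH : socle H ≤ Subgroup.center H) :
    minFaithfulDegree (G × H) = minFaithfulDegree G + minFaithfulDegree H := by
  refine le_antisymm (MuProd.mu_prod_le G H) ?_
  obtain ⟨f, hf⟩ := MuProd.mu_spec (G × H)
  obtain ⟨k, hk, hk'⟩ := MuProd.orbits_list _ f hf
  have hS : (socle G).prod (socle H) ≤ Subgroup.center (G × H) := by
    intro x hx
    rw [Subgroup.mem_center_iff]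
    intro g
    exact Prod.ext (Subgroup.mem_center_iff.1 (hG hx.1) g.1)
      (Subgroup.mem_center_iff.1 (hH hx.2) g.2)
  have hgen : ∀ M : Subgroup (G × H),
      (∀ x ∈ (socle G).prod (socle H), (orderOf x).Prime → x ∈ M) →
      (socle G).prod (socle H) ≤ M := by
    intro M hM
    have h1 : socle G ≤ M.comap (MonoidHom.inl G H) :=
      MuProd.socle_le_of_prime hG _ fun x hx hp => hM _ ⟨hx, Subgroup.one_mem _⟩
        (by rwa [orderOf_injective (MonoidHom.inl G H) (fun _ _ h => congrArg Prod.fst h) x])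
    have h2 : socle H ≤ M.comap (MonoidHom.inr G H) :=
      MuProd.socle_le_of_prime hH _ fun x hx hp => hM _ ⟨Subgroup.one_mem _, hx⟩
        (by rwa [orderOf_injective (MonoidHom.inr G H) (fun _ _ h => congrArg Prod.snd h) x])
    intro x hx
    have := M.mul_mem (h1 hx.1) (h2 hx.2)
    simpa using this
  obtain ⟨l, hl1, hl2, hl3⟩ := MuProd.split_list _ hS hgen k
  obtain ⟨a, b, hab, hab'⟩ := MuProd.exchange _ l hl1 _ le_rfl
    (fun x hx h => hk' x (hS hx) (hl3 x h))
  have ha := MuProd.mu_le a fun x hx h =>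
    congrArg Prod.fst (hab' (x, 1) ⟨hx, Subgroup.one_mem _⟩ h fun B _ => B.one_mem)
  have hb := MuProd.mu_le b fun x hx h =>
    congrArg Prod.snd (hab' (1, x) ⟨Subgroup.one_mem _, hx⟩ (fun A _ => A.one_mem) h)
  omega
end
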